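/- Let n ≥ 2, let ξ be a unit vector in ℝ^{n+1}, and let C ≠ 0 be a real constant. Define w(x) = |C| + C⟨x,ξ⟩ and ρ(x) = 1/w(x) on ω = S^n \ {−sign(C)·ξ}. Then the radial graph {ρ(x)·x : x ∈ ω} equals the paraboloid of revolution consisting of all points p ∈ ℝ^{n+1} whose distance to the origin equals their distance to the directrix hyperplane {q ∈ ℝ^{n+1} : sign(C)⟨q,ξ⟩ = 1/|C|}; equivalently it equals {p ∈ ℝ^{n+1} : |C|·‖p‖ + C⟨p,ξ⟩ = 1}. -/

import Mathlib

open scoped RealInnerProductSpace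

theorem infDist_hyperplane_of_norm_eq_one {E : Type*} [NormedAddCommGroup E]
    [InnerProductSpace ℝ E] {η : E} (hη : ‖η‖ = 1) (p : E) (d : ℝ) :
    Metric.infDist p {q : E | ⟪q, η⟫ = d} = |⟪p, η⟫ - d| := by
  have hfoot : p - (⟪p, η⟫ - d) • η ∈ {q : E | ⟪q, η⟫ = d} := by
    simp [inner_sub_left, real_inner_smul_left, hη]
  apply le_antisymm
  · refine (Metric.infDist_le_dist_of_mem hfoot).trans_eq ?_
    rw [dist_eq_norm, sub_sub_cancel, norm_smul, hη, mul_one, Real.norm_eq_abs]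
  · refine (Metric.le_infDist ⟨_, hfoot⟩).2 fun q hq => ?_
    have hq' : ⟪q, η⟫ = d := hq
    have h := abs_real_inner_le_norm (p - q) η
    rwa [inner_sub_left, hq', hη, mul_one, ← dist_eq_norm] at h

theorem one_add_inner_pos_of_ne_neg {E : Type*} [NormedAddCommGroup E]
    [InnerProductSpace ℝ E] {x η : E} (hx : ‖x‖ = 1) (hη : ‖η‖ = 1) (h : x ≠ -η) :
    0 < 1 + ⟪x, η⟫ := by
  have hpos : 0 < ‖x + η‖ := norm_pos_iff.2 fun h0 => h (eq_neg_of_add_eq_zero_left h0)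
  have hsq := norm_add_sq_real x η
  rw [hx, hη] at hsq
  nlinarith [pow_pos hpos 2]

theorem exists_radial_graph_iff {E : Type*} [NormedAddCommGroup E]
    [InnerProductSpace ℝ E] {η : E} (hη : ‖η‖ = 1) {a : ℝ} (ha : 0 < a) (p : E) :
    (∃ x ∈ Metric.sphere (0 : E) 1, x ≠ -η ∧ p = (1 / (a + a * ⟪x, η⟫)) • x) ↔
      a * ‖p‖ + a * ⟪p, η⟫ = 1 := by
  constructor
  · rintro ⟨x, hx, hne, rfl⟩
    have hx1 : ‖x‖ = 1 := mem_sphere_zero_iff_norm.1 hx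
    have hw : 0 < a + a * ⟪x, η⟫ := by
      nlinarith [mul_pos ha (one_add_inner_pos_of_ne_neg hx1 hη hne)]
    rw [norm_smul, real_inner_smul_left, hx1, Real.norm_of_nonneg (one_div_pos.2 hw).le]
    linear_combination one_div_mul_cancel hw.ne'
  · intro hp
    have hp0 : p ≠ 0 := by
      rintro rfl
      simp at hp
    have hn : 0 < ‖p‖ := norm_pos_iff.2 hp0
    have hw : a + a * ⟪‖p‖⁻¹ • p, η⟫ = ‖p‖⁻¹ := by
      rw [real_inner_smul_left]
      field_simp
      linarith
    refine ⟨‖p‖⁻¹ • p, ?_, ?_, ?_⟩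
    · rw [mem_sphere_zero_iff_norm, norm_smul, norm_inv, norm_norm, inv_mul_cancel₀ hn.ne']
    · intro h
      rw [h, inner_neg_left, real_inner_self_eq_norm_sq, hη] at hw
      have := inv_pos.2 hn
      linarith
    · rw [hw, one_div, inv_inv, smul_inv_smul₀ hn.ne']

theorem norm_eq_infDist_hyperplane_iff {E : Type*} [NormedAddCommGroup E]
    [InnerProductSpace ℝ E] {η : E} (hη : ‖η‖ = 1) {a : ℝ} (ha : 0 < a) (p : E) :
    ‖p‖ = Metric.infDist p {q : E | ⟪q, η⟫ = 1 / a} ↔ a * ‖p‖ + a * ⟪p, η⟫ = 1 := by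
  have hle : ⟪p, η⟫ ≤ ‖p‖ := by simpa [hη] using real_inner_le_norm p η
  have hd : 0 < 1 / a := one_div_pos.2 ha
  have had : a * (1 / a) = 1 := mul_one_div_cancel ha.ne'
  rw [infDist_hyperplane_of_norm_eq_one hη]
  constructor
  · intro h
    rcases abs_cases (⟪p, η⟫ - 1 / a) with ⟨h1, -⟩ | ⟨h1, -⟩
    · linarith
    · rw [h, h1]
      linarith
  · intro h
    have h2 : ‖p‖ = 1 / a - ⟪p, η⟫ := mul_left_cancel₀ ha.ne' (by linarith)
    rw [abs_sub_comm, ← h2, abs_norm]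


theorem paraboloid_from_w (n : ℕ) (hn : 2 ≤ n)
    (ξ : EuclideanSpace ℝ (Fin (n + 1))) (hξ : ‖ξ‖ = 1)
    (C : ℝ) (hC : C ≠ 0) :
    {p : EuclideanSpace ℝ (Fin (n + 1)) |
        ∃ x ∈ Metric.sphere (0 : EuclideanSpace ℝ (Fin (n + 1))) 1,
          x ≠ -(Real.sign C) • ξ ∧ p = (1 / (|C| + C * ⟪x, ξ⟫)) • x} =
      {p : EuclideanSpace ℝ (Fin (n + 1)) |
        ‖p‖ = Metric.infDist p
          {q : EuclideanSpace ℝ (Fin (n + 1)) | Real.sign C * ⟪q, ξ⟫ = 1 / |C|}} ∧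
    {p : EuclideanSpace ℝ (Fin (n + 1)) |
        ∃ x ∈ Metric.sphere (0 : EuclideanSpace ℝ (Fin (n + 1))) 1,
          x ≠ -(Real.sign C) • ξ ∧ p = (1 / (|C| + C * ⟪x, ξ⟫)) • x} =
      {p : EuclideanSpace ℝ (Fin (n + 1)) | |C| * ‖p‖ + C * ⟪p, ξ⟫ = 1} := by
  have ha : 0 < |C| := abs_pos.2 hC
  have hs : |Real.sign C| = 1 := by
    rcases Real.sign_apply_eq_of_ne_zero C hC with h | h <;> simp [h]
  have hη : ‖Real.sign C • ξ‖ = 1 := by rw [norm_smul, hξ, Real.norm_eq_abs, hs, mul_one]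
  have hCs : |C| * Real.sign C = C := by
    rcases hC.lt_or_gt with h | h
    · rw [Real.sign_of_neg h, abs_of_neg h]
      ring
    · rw [Real.sign_of_pos h, abs_of_pos h, mul_one]
  have hinner (q : EuclideanSpace ℝ (Fin (n + 1))) :
      C * ⟪q, ξ⟫ = |C| * ⟪q, Real.sign C • ξ⟫ := by
    rw [real_inner_smul_right, ← mul_assoc, hCs]
  have hsign (q : EuclideanSpace ℝ (Fin (n + 1))) :
      Real.sign C * ⟪q, ξ⟫ = ⟪q, Real.sign C • ξ⟫ := (real_inner_smul_right _ _ _).symm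
  simp only [hinner, hsign, neg_smul]
  constructor
  · ext p
    exact (exists_radial_graph_iff hη ha p).trans (norm_eq_infDist_hyperplane_iff hη ha p).symm
  · ext p
    exact exists_radial_graph_iff hη ha p
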